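/- (Abstract form of Theorem 1.2, Item (2), regular representation version.) Assume hypothesis (★). Then for every finitely supported f: Γ → ℂ, the convolution operator λ_Γ(f) := Σ_{γ∈Γ} f(γ) λ_Γ(γ) on ℓ²(Γ) satisfies ‖λ_Γ(f)‖_{op} ≤ C · ‖f‖_{S^{2d}}, where λ_Γ is the left regular representation of Γ on ℓ²(Γ) (λ_Γ(γ)δ_η = δ_{γη}). In particular, the reduced C*-norm of f is controlled by the Harish-Chandra–Schwartz norm ‖f‖_{S^{2d}}. -/

import Mathlib

open MeasureTheory ENNReal

section QuasiInvariant

variable {Γ X : Type*} [Group Γ] [MeasurableSpace X] [MulAction Γ X] {ν : Measure X}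
  {c : Γ → X → ℝ}

lemma lintegral_comp_smul_eq_lintegral_density_mul
    (hact : ∀ γ : Γ, Measurable (fun x : X => γ • x)) (hc_meas : ∀ γ : Γ, Measurable (c γ))
    (hc : ∀ γ : Γ, Measure.map (fun x : X => γ • x) ν
        = ν.withDensity (fun x => ENNReal.ofReal (c γ x)))
    (γ : Γ) {h : X → ℝ≥0∞} (hh : Measurable h) :
    ∫⁻ x, h (γ • x) ∂ν = ∫⁻ x, ENNReal.ofReal (c γ x) * h x ∂ν := by
  rw [← lintegral_map hh (hact γ), hc γ,
    lintegral_withDensity_eq_lintegral_mul _ (hc_meas γ).ennreal_ofReal hh]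
  rfl

lemma ae_smul_of_ae (hact : ∀ γ : Γ, Measurable (fun x : X => γ • x))
    (hc : ∀ γ : Γ, Measure.map (fun x : X => γ • x) ν
        = ν.withDensity (fun x => ENNReal.ofReal (c γ x)))
    (γ : Γ) {P : X → Prop} (hP : ∀ᵐ x ∂ν, P x) : ∀ᵐ x ∂ν, P (γ • x) := by
  refine ae_of_ae_map (hact γ).aemeasurable ?_
  rw [hc γ]
  exact (withDensity_absolutelyContinuous _ _).ae_le hP

lemma ae_density_cocycle [IsFiniteMeasure ν]
    (hact : ∀ γ : Γ, Measurable (fun x : X => γ • x)) (hc_meas : ∀ γ : Γ, Measurable (c γ))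
    (hc_pos : ∀ γ : Γ, ∀ᵐ x ∂ν, 0 < c γ x)
    (hc : ∀ γ : Γ, Measure.map (fun x : X => γ • x) ν
        = ν.withDensity (fun x => ENNReal.ofReal (c γ x)))
    (ζ γ : Γ) : ∀ᵐ x ∂ν, c (ζ⁻¹ * γ) x = c ζ⁻¹ x * c γ (ζ • x) := by
  have hm : Measurable fun x => ENNReal.ofReal (c ζ⁻¹ x) * ENNReal.ofReal (c γ (ζ • x)) :=
    (hc_meas _).ennreal_ofReal.mul ((hc_meas γ).comp (hact ζ)).ennreal_ofReal
  have key : ν.withDensity (fun x => ENNReal.ofReal (c (ζ⁻¹ * γ) x))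
      = ν.withDensity fun x => ENNReal.ofReal (c ζ⁻¹ x) * ENNReal.ofReal (c γ (ζ • x)) := by
    rw [← hc]
    ext s hs
    have hs1 : Measurable (s.indicator (1 : X → ℝ≥0∞)) := measurable_one.indicator hs
    rw [withDensity_apply _ hs, ← lintegral_indicator_one hs, lintegral_map hs1 (hact _),
      ← lintegral_indicator hs]
    have h1 := lintegral_comp_smul_eq_lintegral_density_mul hact hc_meas hc γ
      (hs1.comp (hact ζ⁻¹))
    have h2 := lintegral_comp_smul_eq_lintegral_density_mul hact hc_meas hc ζ⁻¹
      (h := fun x => ENNReal.ofReal (c γ (ζ • x)) * s.indicator 1 x)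
      (((hc_meas γ).comp (hact ζ)).ennreal_ofReal.mul hs1)
    simp only [Function.comp_apply, smul_inv_smul] at h1 h2
    simp only [mul_smul]
    rw [h1, h2]
    refine lintegral_congr fun x => ?_
    by_cases hx : x ∈ s <;> simp [hx]
  have hae := (withDensity_eq_iff_of_sigmaFinite (hc_meas _).ennreal_ofReal.aemeasurable
    hm.aemeasurable).1 key
  filter_upwards [hae, hc_pos (ζ⁻¹ * γ), hc_pos ζ⁻¹, ae_smul_of_ae hact hc ζ (hc_pos γ)]
    with x h h1 h2 h3
  rw [← ENNReal.ofReal_mul h2.le] at h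
  exact (ENNReal.ofReal_eq_ofReal_iff h1.le (mul_pos h2 h3).le).1 h

lemma ae_sqrt_density_inv [IsFiniteMeasure ν]
    (hact : ∀ γ : Γ, Measurable (fun x : X => γ • x)) (hc_meas : ∀ γ : Γ, Measurable (c γ))
    (hc_pos : ∀ γ : Γ, ∀ᵐ x ∂ν, 0 < c γ x)
    (hc : ∀ γ : Γ, Measure.map (fun x : X => γ • x) ν
        = ν.withDensity (fun x => ENNReal.ofReal (c γ x)))
    (γ : Γ) : ∀ᵐ x ∂ν, √(c γ⁻¹ x) = (√(c γ (γ • x)))⁻¹ := by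
  filter_upwards [ae_density_cocycle hact hc_meas hc_pos hc γ γ,
    ae_density_cocycle hact hc_meas hc_pos hc 1 1, hc_pos 1] with x h h1 h2
  simp only [inv_one, mul_one, one_smul, inv_mul_cancel] at h h1
  have h3 : c 1 x = 1 := by
    have : c 1 x * (c 1 x - 1) = 0 := by linarith
    rcases mul_eq_zero.1 this with h | h <;> linarith
  rw [h3] at h
  rw [← Real.sqrt_inv, eq_inv_of_mul_eq_one_left h.symm]

lemma integral_sqrt_density_inv [IsFiniteMeasure ν]
    (hact : ∀ γ : Γ, Measurable (fun x : X => γ • x)) (hc_meas : ∀ γ : Γ, Measurable (c γ))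
    (hc_pos : ∀ γ : Γ, ∀ᵐ x ∂ν, 0 < c γ x)
    (hc : ∀ γ : Γ, Measure.map (fun x : X => γ • x) ν
        = ν.withDensity (fun x => ENNReal.ofReal (c γ x)))
    (γ : Γ) : ∫ x, √(c γ⁻¹ x) ∂ν = ∫ x, √(c γ x) ∂ν := by
  rw [integral_eq_lintegral_of_nonneg_ae (.of_forall fun _ => Real.sqrt_nonneg _)
      (hc_meas _).sqrt.aestronglyMeasurable,
    integral_eq_lintegral_of_nonneg_ae (.of_forall fun _ => Real.sqrt_nonneg _)
      (hc_meas _).sqrt.aestronglyMeasurable]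
  congr 1
  calc ∫⁻ x, ENNReal.ofReal √(c γ⁻¹ x) ∂ν
      = ∫⁻ x, ENNReal.ofReal (√(c γ (γ • x)))⁻¹ ∂ν := by
        refine lintegral_congr_ae ?_
        filter_upwards [ae_sqrt_density_inv hact hc_meas hc_pos hc γ] with x h
        rw [h]
    _ = ∫⁻ x, ENNReal.ofReal (c γ x) * ENNReal.ofReal (√(c γ x))⁻¹ ∂ν :=
        lintegral_comp_smul_eq_lintegral_density_mul hact hc_meas hc γ
          (h := fun x => ENNReal.ofReal (√(c γ x))⁻¹) (hc_meas γ).sqrt.inv.ennreal_ofReal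
    _ = ∫⁻ x, ENNReal.ofReal √(c γ x) ∂ν := by
        refine lintegral_congr_ae ?_
        filter_upwards [hc_pos γ] with x h
        rw [← ENNReal.ofReal_mul h.le, ← div_eq_mul_inv, Real.div_sqrt]

lemma integral_sqrt_density_pos [IsProbabilityMeasure ν]
    (hact : ∀ γ : Γ, Measurable (fun x : X => γ • x)) (hc_meas : ∀ γ : Γ, Measurable (c γ))
    (hc_pos : ∀ γ : Γ, ∀ᵐ x ∂ν, 0 < c γ x)
    (hc : ∀ γ : Γ, Measure.map (fun x : X => γ • x) ν
        = ν.withDensity (fun x => ENNReal.ofReal (c γ x)))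
    (γ : Γ) : 0 < ∫ x, √(c γ x) ∂ν := by
  have hint : Integrable (c γ) ν := by
    refine ⟨(hc_meas γ).aestronglyMeasurable, ?_⟩
    rw [hasFiniteIntegral_iff_ofReal ((hc_pos γ).mono fun _ h => h.le)]
    have h := lintegral_comp_smul_eq_lintegral_density_mul hact hc_meas hc γ
      (h := fun _ => 1) measurable_const
    simp only [lintegral_const, measure_univ, mul_one] at h
    simp [← h]
  have hint' : Integrable (fun x => √(c γ x)) ν := by
    refine (hint.add (integrable_const (1 : ℝ))).mono' (hc_meas γ).sqrt.aestronglyMeasurable ?_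
    filter_upwards [hc_pos γ] with x h
    rw [Real.norm_of_nonneg (Real.sqrt_nonneg _), Pi.add_apply]
    nlinarith [Real.sq_sqrt h.le, sq_nonneg (√(c γ x) - 1), Real.sqrt_nonneg (c γ x)]
  rw [integral_pos_iff_support_of_nonneg_ae (.of_forall fun _ => Real.sqrt_nonneg _) hint']
  have : ν (Function.support fun x => √(c γ x)) = 1 := by
    rw [← measure_univ (μ := ν)]
    refine measure_congr ?_
    filter_upwards [hc_pos γ] with x h
    exact propext ⟨fun _ => trivial, fun _ => (Real.sqrt_pos.2 h).ne'⟩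
  simp [this]

end QuasiInvariant

lemma ae_tsum_mul_le_of_forall_tsum_lintegral_le {ι X : Type*} [Countable ι] [MeasurableSpace X]
    {ν : Measure X} [SigmaFinite ν] {w : ι → ℝ≥0∞} {g : ι → X → ℝ≥0∞}
    (hg : ∀ i, Measurable (g i)) {C : ℝ≥0∞}
    (h : ∀ ξ : X → ℝ≥0∞, Measurable ξ →
      ∑' i, w i * ∫⁻ x, g i x * ξ x ∂ν ≤ C * ∫⁻ x, ξ x ∂ν) :
    ∀ᵐ x ∂ν, ∑' i, w i * g i x ≤ C := by
  refine ae_le_of_forall_setLIntegral_le_of_sigmaFinite (g := fun _ => C)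
    (Measurable.tsum fun i => (hg i).const_mul _) fun s hs _ => ?_
  have hs1 := h (s.indicator 1) (measurable_one.indicator hs)
  rw [lintegral_indicator_one hs] at hs1
  rw [setLIntegral_const, lintegral_tsum fun i => ((hg i).const_mul _).aemeasurable]
  refine le_of_eq_of_le (tsum_congr fun i => ?_) hs1
  rw [lintegral_const_mul _ (hg i), ← lintegral_indicator hs]
  congr 2 with x
  by_cases hx : x ∈ s <;> simp [hx]

lemma ofReal_norm_sq_eq_tsum {ι : Type*} (v : lp (fun _ : ι => ℂ) 2) :
    ENNReal.ofReal (‖v‖ ^ 2) = ∑' η, ENNReal.ofReal (‖v η‖ ^ 2) := by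
  have h := lp.hasSum_norm (p := 2) (by simp) v
  simp only [ENNReal.toReal_ofNat, Real.rpow_ofNat] at h
  rw [← h.tsum_eq, ENNReal.ofReal_tsum_of_nonneg (fun _ => sq_nonneg _) h.summable]

section Convolution

variable {Γ : Type*} [Group Γ]

/-- The Schur test for convolution by a finitely supported nonnegative function, with a positive
test function `p`. -/
lemma tsum_sq_convolution_le_of_schur_test (F : Finset Γ) {w p u : Γ → ℝ} {C : ℝ}
    (hC : 0 ≤ C) (hw : ∀ γ, 0 ≤ w γ) (hp : ∀ γ, 0 < p γ)
    (hrow : ∀ η, ∑ γ ∈ F, w γ * p (γ⁻¹ * η) ≤ C * p η)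
    (hcol : ∀ η, ∑ γ ∈ F, w γ * p (γ * η) ≤ C * p η) :
    ∑' η, ENNReal.ofReal ((∑ γ ∈ F, w γ * u (γ⁻¹ * η)) ^ 2)
      ≤ ENNReal.ofReal (C ^ 2) * ∑' η, ENNReal.ofReal (u η ^ 2) := by
  have hpt (η : Γ) : (∑ γ ∈ F, w γ * u (γ⁻¹ * η)) ^ 2
      ≤ ∑ γ ∈ F, C * (w γ * (p (γ * (γ⁻¹ * η)) * (u (γ⁻¹ * η) ^ 2 / p (γ⁻¹ * η)))) := by
    have hcs := Finset.sum_sq_le_sum_mul_sum_of_sq_le_mul F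
      (r := fun γ => w γ * u (γ⁻¹ * η)) (f := fun γ => w γ * p (γ⁻¹ * η))
      (g := fun γ => w γ * (u (γ⁻¹ * η) ^ 2 / p (γ⁻¹ * η)))
      (fun γ _ => mul_nonneg (hw γ) (hp _).le)
      (fun γ _ => mul_nonneg (hw γ) (div_nonneg (sq_nonneg _) (hp _).le))
      (fun γ _ => by have := (hp (γ⁻¹ * η)).ne'; apply le_of_eq; field_simp)
    refine hcs.trans ((mul_le_mul_of_nonneg_right (hrow η) (Finset.sum_nonneg
      fun γ _ => mul_nonneg (hw γ) (div_nonneg (sq_nonneg _) (hp _).le))).trans_eq ?_)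
    rw [Finset.mul_sum]
    refine Finset.sum_congr rfl fun γ _ => ?_
    rw [mul_inv_cancel_left]
    ring
  have hnn (γ η : Γ) : 0 ≤ C * (w γ * (p (γ * η) * (u η ^ 2 / p η))) :=
    mul_nonneg hC (mul_nonneg (hw γ) (mul_nonneg (hp _).le (div_nonneg (sq_nonneg _) (hp _).le)))
  calc ∑' η, ENNReal.ofReal ((∑ γ ∈ F, w γ * u (γ⁻¹ * η)) ^ 2)
      ≤ ∑' η, ∑ γ ∈ F, ENNReal.ofReal
          (C * (w γ * (p (γ * (γ⁻¹ * η)) * (u (γ⁻¹ * η) ^ 2 / p (γ⁻¹ * η))))) := by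
        refine ENNReal.tsum_le_tsum fun η => ?_
        rw [← ENNReal.ofReal_sum_of_nonneg fun γ _ => hnn γ _]
        exact ENNReal.ofReal_le_ofReal (hpt η)
    _ = ∑ γ ∈ F, ∑' η, ENNReal.ofReal (C * (w γ * (p (γ * η) * (u η ^ 2 / p η)))) := by
        rw [Summable.tsum_finsetSum fun _ _ => ENNReal.summable]
        exact Finset.sum_congr rfl fun γ _ => (Equiv.mulLeft γ⁻¹).tsum_eq
          fun η => ENNReal.ofReal (C * (w γ * (p (γ * η) * (u η ^ 2 / p η))))
    _ = ∑' η, ENNReal.ofReal (∑ γ ∈ F, C * (w γ * (p (γ * η) * (u η ^ 2 / p η)))) := by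
        rw [← Summable.tsum_finsetSum fun _ _ => ENNReal.summable]
        exact tsum_congr fun η => (ENNReal.ofReal_sum_of_nonneg fun γ _ => hnn γ _).symm
    _ ≤ ∑' η, ENNReal.ofReal (C ^ 2) * ENNReal.ofReal (u η ^ 2) := by
        refine ENNReal.tsum_le_tsum fun η => ?_
        rw [← ENNReal.ofReal_mul (sq_nonneg C)]
        refine ENNReal.ofReal_le_ofReal ?_
        have hp' := (hp η).ne'
        calc ∑ γ ∈ F, C * (w γ * (p (γ * η) * (u η ^ 2 / p η)))
            = (∑ γ ∈ F, w γ * p (γ * η)) * (C * (u η ^ 2 / p η)) := by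
              rw [Finset.sum_mul]
              exact Finset.sum_congr rfl fun γ _ => by ring
          _ ≤ (C * p η) * (C * (u η ^ 2 / p η)) :=
              mul_le_mul_of_nonneg_right (hcol η)
                (mul_nonneg hC (div_nonneg (sq_nonneg _) (hp η).le))
          _ = C ^ 2 * u η ^ 2 := by field_simp
    _ = _ := ENNReal.tsum_mul_left

lemma translation_apply_of_apply_single [DecidableEq Γ] {γ : Γ}
    {T : lp (fun _ : Γ => ℂ) 2 →L[ℂ] lp (fun _ : Γ => ℂ) 2}
    (hT : ∀ η : Γ, T (lp.single 2 η 1) = lp.single 2 (γ * η) 1)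
    (v : lp (fun _ : Γ => ℂ) 2) (η : Γ) : T v η = v (γ⁻¹ * η) := by
  have hv := lp.hasSum_single (p := 2) (by simp) v
  have heval (ζ : Γ) : Continuous fun v : lp (fun _ : Γ => ℂ) 2 => v ζ :=
    (lp.evalCLM ℂ (fun _ : Γ => ℂ) 2 ζ).continuous
  have h1 : HasSum (fun ζ => lp.single 2 ζ (v ζ) (γ⁻¹ * η)) (v (γ⁻¹ * η)) :=
    hv.map (lp.evalCLM ℂ (fun _ : Γ => ℂ) 2 (γ⁻¹ * η)) (heval _)
  have h2 : HasSum (fun ζ => T (lp.single 2 ζ (v ζ)) η) (T v η) :=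
    (hv.mapL T).map (lp.evalCLM ℂ (fun _ : Γ => ℂ) 2 η) (heval _)
  refine h2.unique ?_
  convert h1 using 2 with ζ
  have : lp.single (E := fun _ : Γ => ℂ) 2 ζ (v ζ) = v ζ • lp.single 2 ζ (1 : ℂ) := by
    rw [← lp.single_smul]; simp
  rw [this, map_smul, hT]
  simp only [lp.coeFn_smul, Pi.smul_apply, lp.single_apply, Pi.single_apply,
    inv_mul_eq_iff_eq_mul]

lemma norm_sum_smul_translation_le_of_schur_test [DecidableEq Γ]
    {lam : Γ → (lp (fun _ : Γ => ℂ) 2 →L[ℂ] lp (fun _ : Γ => ℂ) 2)}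
    (hlam : ∀ γ η : Γ, lam γ (lp.single 2 η 1) = lp.single 2 (γ * η) 1)
    (F : Finset Γ) {f : Γ → ℂ} {w p : Γ → ℝ} {C S : ℝ}
    (hC : 0 ≤ C) (hS : 0 ≤ S) (hw : ∀ γ, 0 ≤ w γ) (hp : ∀ γ, 0 < p γ)
    (hf : ∀ γ, ‖f γ‖ ≤ S * w γ)
    (hrow : ∀ η, ∑ γ ∈ F, w γ * p (γ⁻¹ * η) ≤ C * p η)
    (hcol : ∀ η, ∑ γ ∈ F, w γ * p (γ * η) ≤ C * p η) :
    ‖∑ γ ∈ F, f γ • lam γ‖ ≤ C * S := by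
  refine ContinuousLinearMap.opNorm_le_bound _ (mul_nonneg hC hS) fun v => ?_
  have hnn : 0 ≤ C * S * ‖v‖ := by positivity
  rw [← sq_le_sq₀ (norm_nonneg _) hnn, ← ENNReal.ofReal_le_ofReal_iff (sq_nonneg _),
    ofReal_norm_sq_eq_tsum]
  have hval (η : Γ) : ((∑ γ ∈ F, f γ • lam γ) v) η = ∑ γ ∈ F, f γ * v (γ⁻¹ * η) := by
    rw [_root_.sum_apply, lp.coeFn_sum, Finset.sum_apply]
    refine Finset.sum_congr rfl fun γ _ => ?_
    rw [← translation_apply_of_apply_single (hlam γ)]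
    rfl
  calc ∑' η, ENNReal.ofReal (‖((∑ γ ∈ F, f γ • lam γ) v) η‖ ^ 2)
      ≤ ∑' η, ENNReal.ofReal (S ^ 2) *
          ENNReal.ofReal ((∑ γ ∈ F, w γ * ‖v (γ⁻¹ * η)‖) ^ 2) := by
        refine ENNReal.tsum_le_tsum fun η => ?_
        rw [← ENNReal.ofReal_mul (sq_nonneg S), ← mul_pow, hval]
        refine ENNReal.ofReal_le_ofReal (pow_le_pow_left₀ (norm_nonneg _) ?_ 2)
        rw [Finset.mul_sum]
        refine norm_sum_le_of_le _ fun γ _ => ?_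
        rw [norm_mul, ← mul_assoc]
        exact mul_le_mul_of_nonneg_right (hf γ) (norm_nonneg _)
    _ ≤ ENNReal.ofReal (S ^ 2) * (ENNReal.ofReal (C ^ 2) *
          ∑' η, ENNReal.ofReal (‖v η‖ ^ 2)) := by
        rw [ENNReal.tsum_mul_left]
        exact mul_le_mul' le_rfl (tsum_sq_convolution_le_of_schur_test F
          (u := fun η => ‖v η‖) hC hw hp hrow hcol)
    _ = ENNReal.ofReal ((C * S * ‖v‖) ^ 2) := by
        rw [← ofReal_norm_sq_eq_tsum, ← ENNReal.ofReal_mul (sq_nonneg C),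
          ← ENNReal.ofReal_mul (sq_nonneg S)]
        ring_nf

end Convolution

/-- Abstract form of Theorem 1.2, Item (2), regular representation version:
under hypothesis (★), for every finitely supported `f : Γ → ℂ` the convolution
operator `λ_Γ(f) = Σ_γ f(γ) λ_Γ(γ)` on `ℓ²(Γ)` satisfies
`‖λ_Γ(f)‖ ≤ C ‖f‖_{S^{2d}}`, where `λ_Γ` is the left regular representation
(`λ_Γ(γ)δ_η = δ_{γη}`) and `‖f‖_{S^{2d}} = sup_γ |f(γ)|(1+L(γ))^{2d}/Ξ(γ)`;
that is, the reduced C*-norm of `f` is controlled by the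
Harish-Chandra--Schwartz norm. -/
theorem reduced_norm_harish_chandra_schwartz_bound
    {Γ : Type*} [Group Γ] [Countable Γ] [DecidableEq Γ]
    {X : Type*} [MeasurableSpace X] [MulAction Γ X]
    (ν : Measure X) [IsProbabilityMeasure ν]
    (hact : ∀ γ : Γ, Measurable (fun x : X => γ • x))
    (c : Γ → X → ℝ)
    (hc_meas : ∀ γ : Γ, Measurable (c γ))
    (hc_pos : ∀ γ : Γ, ∀ᵐ x ∂ν, 0 < c γ x)
    (hc : ∀ γ : Γ, Measure.map (fun x : X => γ • x) ν
        = ν.withDensity (fun x => ENNReal.ofReal (c γ x)))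
    (Ξ : Γ → ℝ) (hΞ : ∀ γ : Γ, Ξ γ = ∫ x, Real.sqrt (c γ x) ∂ν)
    (L : Γ → ℝ) (hL_nonneg : ∀ γ, 0 ≤ L γ) (hL_one : L 1 = 0)
    (hL_inv : ∀ γ, L γ⁻¹ = L γ) (hL_sub : ∀ γ δ : Γ, L (γ * δ) ≤ L γ + L δ)
    (d : ℝ) (hd : 0 < d) (C : ℝ) (hC : 0 < C)
    (hstar : ∀ ξ : X → ℝ≥0∞, Measurable ξ →
      ∑' γ : Γ, ENNReal.ofReal (Ξ γ / (1 + L γ) ^ (2 * d))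
          * ∫⁻ x, ENNReal.ofReal (Real.sqrt (c γ x)) * ξ x ∂ν
        ≤ ENNReal.ofReal C * ∫⁻ x, ξ x ∂ν)
    (lam : Γ → (lp (fun _ : Γ => ℂ) 2 →L[ℂ] lp (fun _ : Γ => ℂ) 2))
    (hlam : ∀ γ η : Γ, lam γ (lp.single 2 η 1) = lp.single 2 (γ * η) 1)
    (f : Γ → ℂ) (hf : f.support.Finite) :
    ‖∑ γ ∈ hf.toFinset, f γ • lam γ‖
      ≤ C * ⨆ γ : Γ, ‖f γ‖ * (1 + L γ) ^ (2 * d) / Ξ γ := by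
  set w : Γ → ℝ := fun γ => Ξ γ / (1 + L γ) ^ (2 * d) with hw_def
  have hΞ_pos (γ : Γ) : 0 < Ξ γ := by
    rw [hΞ]
    exact integral_sqrt_density_pos hact hc_meas hc_pos hc γ
  have hL_pos (γ : Γ) : 0 < (1 + L γ) ^ (2 * d) :=
    Real.rpow_pos_of_pos (by linarith [hL_nonneg γ]) _
  have hw_pos (γ : Γ) : 0 < w γ := div_pos (hΞ_pos γ) (hL_pos γ)
  have hw_inv (γ : Γ) : w γ⁻¹ = w γ := by
    simp only [hw_def, hL_inv, hΞ, integral_sqrt_density_inv hact hc_meas hc_pos hc γ]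
  have hsum : ∀ᵐ x ∂ν, ∀ ζ : Γ, ∑' γ, ENNReal.ofReal (w γ) * ENNReal.ofReal √(c γ (ζ • x))
      ≤ ENNReal.ofReal C :=
    ae_all_iff.2 fun ζ => ae_smul_of_ae hact hc ζ
      (ae_tsum_mul_le_of_forall_tsum_lintegral_le
        (fun γ => (hc_meas γ).sqrt.ennreal_ofReal) hstar)
  have hcocycle : ∀ᵐ x ∂ν, ∀ ζ γ : Γ, c (ζ⁻¹ * γ) x = c ζ⁻¹ x * c γ (ζ • x) :=
    ae_all_iff.2 fun ζ => ae_all_iff.2 (ae_density_cocycle hact hc_meas hc_pos hc ζ)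
  obtain ⟨x, hsum, hcocycle, hpos⟩ := (hsum.and (hcocycle.and (ae_all_iff.2 hc_pos))).exists
  have hrow (F : Finset Γ) (η : Γ) :
      ∑ γ ∈ F, w γ * √(c (γ⁻¹ * η)⁻¹ x) ≤ C * √(c η⁻¹ x) := by
    have hle : ∑ γ ∈ F, w γ * √(c γ (η • x)) ≤ C := by
      rw [← ENNReal.ofReal_le_ofReal_iff hC.le, ENNReal.ofReal_sum_of_nonneg
        fun γ _ => mul_nonneg (hw_pos γ).le (Real.sqrt_nonneg _)]
      simp only [ENNReal.ofReal_mul (hw_pos _).le]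
      exact (ENNReal.sum_le_tsum F).trans (hsum η)
    refine le_of_eq_of_le ?_ (mul_le_mul_of_nonneg_right hle (Real.sqrt_nonneg (c η⁻¹ x)))
    rw [Finset.sum_mul]
    refine Finset.sum_congr rfl fun γ _ => ?_
    rw [mul_inv_rev, inv_inv, hcocycle, Real.sqrt_mul (hpos _).le]
    ring
  have hbdd : BddAbove (Set.range fun γ => ‖f γ‖ * (1 + L γ) ^ (2 * d) / Ξ γ) := by
    refine Set.Finite.bddAbove (((hf.image fun γ => ‖f γ‖ * (1 + L γ) ^ (2 * d) / Ξ γ).union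
      (Set.finite_singleton 0)).subset ?_)
    rintro _ ⟨γ, rfl⟩
    by_cases h : f γ = 0
    · exact Or.inr (by simp [h])
    · exact Or.inl ⟨γ, h, rfl⟩
  refine norm_sum_smul_translation_le_of_schur_test hlam hf.toFinset (w := w)
    (p := fun η => √(c η⁻¹ x)) hC.le (Real.iSup_nonneg fun γ => ?_) (fun γ => (hw_pos γ).le)
    (fun γ => Real.sqrt_pos.2 (hpos _)) (fun γ => ?_) (hrow _) (fun η => ?_)
  · exact div_nonneg (mul_nonneg (norm_nonneg _) (hL_pos γ).le) (hΞ_pos γ).le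
  · refine le_of_eq_of_le ?_ (mul_le_mul_of_nonneg_right (le_ciSup hbdd γ) (hw_pos γ).le)
    have h1 := (hL_pos γ).ne'
    have h2 := (hΞ_pos γ).ne'
    simp only [hw_def]
    field_simp
  · have h := hrow (hf.toFinset.map (Equiv.inv Γ).toEmbedding) η
    simpa [Finset.sum_map, hw_inv] using h
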